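/- Let μ be a singular cardinal. Suppose there is a scale (⟨μ_i : i < cf(μ)⟩, ⟨f_α : α < μ⁺⟩) for μ such that for every i < cf(μ), μ_i is the double cardinal successor κ_i⁺⁺ of some uncountable regular cardinal κ_i. Then pr₁(μ⁺, μ⁺, μ⁺, cf(μ)) holds. -/

import Mathlib

noncomputable section

open Set

/-- The successor cardinal of `mu`, as an ordinal. -/
def sucOrd (mu : Cardinal) : Ordinal := (Order.succ mu).ord

/-- The cofinality of `mu`, as an ordinal. -/
def cofOrd (mu : Cardinal) : Ordinal := (Ordinal.cof mu.ord).ord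

/-- `mu` is a singular cardinal: infinite, with cofinality smaller than itself. -/
def IsSingular (mu : Cardinal) : Prop :=
  Cardinal.aleph0 ≤ mu ∧ Ordinal.cof mu.ord < mu

/-- `C` is unbounded below `lam`. -/
def UnbddIn (C : Set Ordinal) (lam : Ordinal) : Prop :=
  ∀ x < lam, ∃ y ∈ C, x ≤ y ∧ y < lam

/-- `C` is closed below `lam`: any accumulation point below `lam` belongs to `C`. -/
def ClosedIn (C : Set Ordinal) (lam : Ordinal) : Prop :=
  ∀ δ, δ < lam → 0 < δ → (∀ x < δ, ∃ y ∈ C, x < y ∧ y < δ) → δ ∈ C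

/-- `C` is a closed unbounded subset of `lam`. -/
def IsClubIn (C : Set Ordinal) (lam : Ordinal) : Prop :=
  C ⊆ Set.Iio lam ∧ ClosedIn C lam ∧ UnbddIn C lam

/-- `S` is a stationary subset of `lam`: it meets every closed unbounded subset of `lam`. -/
def IsStatIn (S : Set Ordinal) (lam : Ordinal) : Prop :=
  S ⊆ Set.Iio lam ∧ ∀ C, IsClubIn C lam → (S ∩ C).Nonempty

/-- The set of ordinals `t` has cardinality `< kappa`. -/
def CardLT (t : Set Ordinal) (kappa : Cardinal) : Prop :=
  (Cardinal.mk ↥t : Cardinal.{1}) < Cardinal.lift.{1, 0} kappa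

/-- `c` witnesses Shelah's principle `pr₁(μ⁺, μ⁺, σ, cf μ)`: for every sequence
`⟨t_α : α < μ⁺⟩` of pairwise disjoint subsets of `μ⁺`, each of size `< cf μ`, and every
color `ε < σ`, there are `α < β < μ⁺` with `c` constantly `ε` on pairs from `t_α × t_β`. -/
def Pr1With (mu sigma : Cardinal) (c : Ordinal → Ordinal → Ordinal) : Prop :=
  (∀ a b, a < b → b < sucOrd mu → c a b < sigma.ord) ∧
  ∀ t : Ordinal → Set Ordinal,
    (∀ a, a < sucOrd mu → t a ⊆ Set.Iio (sucOrd mu)) →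
    (∀ a b, a < sucOrd mu → b < sucOrd mu → a ≠ b → Disjoint (t a) (t b)) →
    (∀ a, a < sucOrd mu → CardLT (t a) (Ordinal.cof mu.ord)) →
    ∀ ε, ε < sigma.ord →
      ∃ α β, α < β ∧ β < sucOrd mu ∧
        ∀ ξ ∈ t α, ∀ ζ ∈ t β, c (min ξ ζ) (max ξ ζ) = ε

/-- Shelah's principle `pr₁(μ⁺, μ⁺, σ, cf μ)`. -/
def Pr1 (mu sigma : Cardinal) : Prop := ∃ c, Pr1With mu sigma c

/-- `(mus, f)` is a scale for the singular cardinal `mu`. -/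
structure IsScale (mu : Cardinal) (mus : Ordinal → Cardinal)
    (f : Ordinal → Ordinal → Ordinal) : Prop where
  regular : ∀ i, i < cofOrd mu → (mus i).IsRegular
  strictMono : ∀ i j, i < j → j < cofOrd mu → mus i < mus j
  le_mu : ∀ i, i < cofOrd mu → mus i ≤ mu
  unbdd : ∀ θ, θ < mu → ∃ i, i < cofOrd mu ∧ θ < mus i
  cof_lt : Ordinal.cof mu.ord < mus 0
  f_lt : ∀ α, α < sucOrd mu → ∀ i, i < cofOrd mu → f α i < (mus i).ord
  f_mono : ∀ α β, α < β → β < sucOrd mu →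
    ∃ i0, i0 < cofOrd mu ∧ ∀ i, i0 ≤ i → i < cofOrd mu → f α i < f β i
  f_cofinal : ∀ g : Ordinal → Ordinal, (∀ i, i < cofOrd mu → g i < (mus i).ord) →
    ∃ α, α < sucOrd mu ∧ ∃ i0, i0 < cofOrd mu ∧ ∀ i, i0 ≤ i → i < cofOrd mu → g i < f α i

/-- The minimal walk from `b` down to `a` along the C-sequence `e`:
`walk e a b 0 = b` and `walk e a b (n+1) = min (e (walk e a b n) \ a)`,
staying at `a` once it is reached. -/
def walk (e : Ordinal → Set Ordinal) (a b : Ordinal) : ℕ → Ordinal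
  | 0 => b
  | n + 1 => if walk e a b n = a then a else sInf (e (walk e a b n) ∩ Set.Ici a)

/-- `ρ₂(a,b)`: the length of the minimal walk from `b` to `a`, i.e. the least `n`
with `walk e a b n = a`. -/
def rho2 (e : Ordinal → Set Ordinal) (a b : Ordinal) : ℕ :=
  sInf {n : ℕ | walk e a b n = a}

/-- `β_i⁻(a,b)`: zero for `i = 0`, and `sup (e_{β_j(a,b)} ∩ a)` for `i = j+1`. -/
def walkLow (e : Ordinal → Set Ordinal) (a b : Ordinal) : ℕ → Ordinal
  | 0 => 0
  | j + 1 => sSup (e (walk e a b j) ∩ Set.Iio a)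

/-- `γ(a,b) = β_{ρ₂(a,b)-1}(a,b)`, the last step before the walk reaches `a`. -/
def gammaW (e : Ordinal → Set Ordinal) (a b : Ordinal) : Ordinal :=
  walk e a b (rho2 e a b - 1)

/-- `γ⁻(a,b) = max {β_i⁻(a,b) : i < ρ₂(a,b)}`. -/
def gammaMinusW (e : Ordinal → Set Ordinal) (a b : Ordinal) : Ordinal :=
  sSup (walkLow e a b '' {i : ℕ | i < rho2 e a b})

/-- `η(a,b) = max {β_i⁻(a,b) : i ≤ ρ₂(a,b)}`. -/
def etaW (e : Ordinal → Set Ordinal) (a b : Ordinal) : Ordinal :=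
  sSup (walkLow e a b '' {i : ℕ | i ≤ rho2 e a b})

/-- `e` is a C-sequence on `lam`: each `e ξ` is closed unbounded in `ξ`. -/
def IsCSeq (e : Ordinal → Set Ordinal) (lam : Ordinal) : Prop :=
  ∀ ξ, ξ < lam → IsClubIn (e ξ) ξ

/-- `ξ` is an accumulation point of `C`: `ξ = sup (C ∩ ξ) > 0`. -/
def IsAccOf (C : Set Ordinal) (ξ : Ordinal) : Prop :=
  0 < ξ ∧ sSup (C ∩ Set.Iio ξ) = ξ

/-- The non-accumulation points of `C`. -/
def naccOf (C : Set Ordinal) : Set Ordinal :=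
  {ξ ∈ C | sSup (C ∩ Set.Iio ξ) < ξ}


/-- A well-order of regular infinite cardinal length. -/
structure RegOrd (Θ : Type) [LinearOrder Θ] : Prop where
  inf : Cardinal.aleph0 ≤ Cardinal.mk Θ
  bdd : ∀ X : Set Θ, Cardinal.mk X < Cardinal.mk Θ → ∃ b, ∀ x ∈ X, x < b
  seg : ∀ a : Θ, Cardinal.mk (Iio a) < Cardinal.mk Θ

/-- The points closed under `B`. -/
def Cl {Θ : Type} [LinearOrder Θ] (B : Θ → Θ) : Set Θ := {δ | ∀ ν < δ, B ν < δ}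

/-- Unbounded sets. -/
def Unb {Θ : Type} [LinearOrder Θ] (G : Set Θ) : Prop := ∀ a, ∃ g ∈ G, a < g

/-- Stationary sets, tested against sets of closure points. -/
def Stat {Θ : Type} [LinearOrder Θ] (T : Set Θ) : Prop :=
  ∀ (B : Θ → Θ) (a : Θ), ∃ δ ∈ T, a < δ ∧ δ ∈ Cl B

/-- `δ` is a limit of cofinality at least `ρ`. -/
def CofGE {Θ : Type} [LinearOrder Θ] (ρ : Cardinal) (δ : Θ) : Prop :=
  ∀ X ⊆ Iio δ, Cardinal.mk X < ρ → ∃ ν < δ, ∀ x ∈ X, x ≤ ν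

theorem exists_wf_seq {R Y : Type} [LinearOrder R] [WellFoundedLT R] (P : Y → Y → Prop)
    (h : ∀ (ξ : R) (s : Iio ξ → Y), ∃ y, ∀ η, P (s η) y) :
    ∃ u : R → Y, ∀ η ξ, η < ξ → P (u η) (u ξ) := by
  choose F hF using h
  let u : R → Y := (wellFounded_lt (α := R)).fix fun ξ s => F ξ fun η => s η.1 η.2
  refine ⟨u, fun η ξ hη => ?_⟩
  have : u ξ = F ξ fun η => u η.1 := WellFounded.fix_eq _ _ _
  rw [this]
  exact hF ξ (fun η => u η.1) ⟨η, hη⟩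

theorem exists_isLUB_of_wf {Θ : Type} [LinearOrder Θ] [WellFoundedLT Θ] {X : Set Θ}
    (h : (upperBounds X).Nonempty) : ∃ δ, IsLUB X δ := by
  refine ⟨(wellFounded_lt (α := Θ)).min _ h, WellFounded.min_mem _ _ h, fun y hy => ?_⟩
  exact not_lt.1 ((wellFounded_lt (α := Θ)).not_lt_min _ hy)

namespace RegOrd

variable {Θ : Type} [LinearOrder Θ]

theorem nonempty (hΘ : RegOrd Θ) : Nonempty Θ :=
  Cardinal.mk_ne_zero_iff.1 (Cardinal.aleph0_pos.trans_le hΘ.inf).ne'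

theorem bddf (hΘ : RegOrd Θ) {K : Type} (hK : Cardinal.mk K < Cardinal.mk Θ) (f : K → Θ) : ∃ b, ∀ k, f k < b := by
  obtain ⟨b, hb⟩ := hΘ.bdd (range f) (Cardinal.mk_range_le.trans_lt hK)
  exact ⟨b, fun k => hb _ ⟨k, rfl⟩⟩

theorem exists_gt (hΘ : RegOrd Θ) (a : Θ) : ∃ b, a < b := by
  obtain ⟨b, hb⟩ := hΘ.bddf (K := Unit) (by simpa using Cardinal.one_lt_aleph0.trans_le hΘ.inf)
    fun _ => a
  exact ⟨b, hb ()⟩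

theorem exists_gt₂ (hΘ : RegOrd Θ) (a b : Θ) : ∃ c, a < c ∧ b < c := by
  obtain ⟨c, hc⟩ := hΘ.exists_gt (max a b)
  exact ⟨c, (le_max_left _ _).trans_lt hc, (le_max_right _ _).trans_lt hc⟩

theorem exists_bound_le (hΘ : RegOrd Θ) (f : Θ → Θ) (a : Θ) : ∃ b, ∀ x ≤ a, f x < b := by
  obtain ⟨a', ha'⟩ := hΘ.exists_gt a
  obtain ⟨b, hb⟩ := hΘ.bddf (hΘ.seg a') fun x => f x
  exact ⟨b, fun x hx => hb ⟨x, hx.trans_lt ha'⟩⟩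

theorem unb_pigeonhole (hΘ : RegOrd Θ) {K : Type} (hK : Cardinal.mk K < Cardinal.mk Θ) {G : Set Θ} (hG : Unb G)
    (k : Θ → K) : ∃ k₀, Unb {x ∈ G | k x = k₀} := by
  by_contra! hc
  simp only [Unb, not_forall, not_exists, not_and, not_lt] at hc
  choose a ha using hc
  obtain ⟨b, hb⟩ := hΘ.bddf hK a
  obtain ⟨g, hg, hbg⟩ := hG b
  exact absurd (ha (k g) g ⟨hg, rfl⟩) (not_le.2 ((hb _).trans hbg))

theorem stat_pigeonhole (hΘ : RegOrd Θ) {K : Type} (hK : Cardinal.mk K < Cardinal.mk Θ) {G : Set Θ} (hG : Stat G)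
    (k : Θ → K) : ∃ k₀, Stat {x ∈ G | k x = k₀} := by
  by_contra! hc
  simp only [Stat, not_forall, not_exists, not_and] at hc
  choose B a ha using hc
  obtain ⟨b, hb⟩ := hΘ.bddf hK a
  choose B' hB' using fun ν => hΘ.bddf hK fun k => B k ν
  obtain ⟨g, hg, hbg, hgB⟩ := hG B' b
  exact ha (k g) g ⟨hg, rfl⟩ ((hb _).trans hbg) fun ν hν => (hB' ν _).trans (hgB ν hν)

theorem fodor (hΘ : RegOrd Θ) {K : Type} (hK : Cardinal.mk K < Cardinal.mk Θ) {T : Set Θ} (hT : Stat T)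
    (g : Θ → Θ) (hg : ∀ δ ∈ T, g δ < δ) (k : Θ → K) :
    ∃ ν k₀, Unb {δ ∈ T | g δ = ν ∧ k δ = k₀} := by
  by_contra! hc
  simp only [Unb, not_forall, not_exists, not_and, not_lt] at hc
  choose a ha using hc
  choose B hB using fun ν => hΘ.bddf hK fun k => a ν k
  obtain ⟨x₀⟩ := hΘ.nonempty
  obtain ⟨δ, hδ, -, hδB⟩ := hT B x₀
  have h1 := ha (g δ) (k δ) δ ⟨hδ, rfl, rfl⟩
  exact absurd h1 (not_le.2 ((hB _ _).trans (hδB _ (hg δ hδ))))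

theorem stat_cofGE (hΘ : RegOrd Θ) [WellFoundedLT Θ] {R : Type} [LinearOrder R] [WellFoundedLT R] (hR : RegOrd R)
    (hlt : Cardinal.mk R < Cardinal.mk Θ) : Stat {δ : Θ | CofGE (Cardinal.mk R) δ} := by
  intro B a
  choose Bh hBh using fun y => hΘ.exists_bound_le (fun x => max (B x) (max x a)) y
  obtain ⟨u, hu⟩ := exists_wf_seq (R := R) (fun y z => Bh y < z)
    fun ξ s => hΘ.bddf ((hR.seg ξ).trans hlt) fun η => Bh (s η)
  have hmono : ∀ η ξ, η < ξ → u η < u ξ := fun η ξ h =>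
    ((le_max_left _ _).trans (le_max_right _ _)).trans_lt ((hBh _ _ le_rfl).trans (hu _ _ h))
  obtain ⟨c, hc⟩ := hΘ.bddf hlt u
  obtain ⟨δ, hδ⟩ := exists_isLUB_of_wf (X := range u) ⟨c, by rintro _ ⟨r, rfl⟩; exact (hc r).le⟩
  have hlt' : ∀ r, u r < δ := fun r => by
    obtain ⟨r', hr'⟩ := hR.exists_gt r
    exact (hmono _ _ hr').trans_le (hδ.1 ⟨r', rfl⟩)
  have hex : ∀ ν < δ, ∃ r, ν < u r := fun ν hν => by
    obtain ⟨_, ⟨r, rfl⟩, h⟩ := (lt_isLUB_iff hδ).1 hν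
    exact ⟨r, h⟩
  refine ⟨δ, fun X hX hXR => ?_, ?_, fun ν hν => ?_⟩
  · choose r hr using fun x : X => hex x (hX x.2)
    obtain ⟨b, hb⟩ := hR.bddf hXR r
    exact ⟨u b, hlt' b, fun x hx => ((hr ⟨x, hx⟩).trans (hmono _ _ (hb _))).le⟩
  · obtain ⟨r₀⟩ := hR.nonempty
    obtain ⟨r', hr'⟩ := hR.exists_gt r₀
    exact ((le_max_right _ _).trans (le_max_right _ _)).trans_lt ((hBh _ _ le_rfl).trans
      ((hu _ _ hr').trans (hlt' r')))
  · obtain ⟨r, hr⟩ := hex ν hν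
    obtain ⟨r', hr'⟩ := hR.exists_gt r
    exact (le_max_left _ _).trans_lt ((hBh _ _ hr.le).trans ((hu _ _ hr').trans (hlt' r')))

theorem mk_of_unb (hΘ : RegOrd Θ) {A : Set Θ} (hA : Unb A) : Cardinal.mk A = Cardinal.mk Θ := by
  refine le_antisymm (Cardinal.mk_set_le A) (not_lt.1 fun h => ?_)
  obtain ⟨b, hb⟩ := hΘ.bdd A h
  obtain ⟨g, hg, hbg⟩ := hA b
  exact lt_asymm hbg (hb g hg)

/-- Ulam's splitting of a stationary set on a successor cardinal. -/
theorem stat_split (hΘ : RegOrd Θ) {R K : Type} [Nonempty K] (hR : Cardinal.mk R < Cardinal.mk Θ)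
    (hK : Cardinal.mk K ≤ Cardinal.mk Θ) (p : Θ → Θ → R) (hp : ∀ y, InjOn (p y) (Iio y))
    {S : Set Θ} (hS : Stat S) : ∃ k : Θ → K, ∀ κ, Stat {δ ∈ S | k δ = κ} := by
  have h1 : ∀ α, ∃ r, Stat {δ ∈ {δ ∈ S | α < δ} | p δ α = r} := fun α => by
    refine hΘ.stat_pigeonhole hR (fun B a => ?_) fun δ => p δ α
    obtain ⟨δ, h, ha, hB⟩ := hS B (max a α)
    exact ⟨δ, ⟨h, (le_max_right _ _).trans_lt ha⟩, (le_max_left _ _).trans_lt ha, hB⟩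
  choose r hr using h1
  obtain ⟨r₀, hA⟩ := hΘ.unb_pigeonhole hR (G := univ) (fun a => by simpa using hΘ.exists_gt a) r
  obtain ⟨j⟩ : Nonempty (K ↪ {x ∈ univ | r x = r₀}) := by
    rw [← Cardinal.le_def, hΘ.mk_of_unb hA]; exact hK
  classical
  refine ⟨fun δ => if h : ∃ κ, (j κ).1 < δ ∧ p δ (j κ) = r₀ then h.choose else Classical.arbitrary K,
    fun κ B a => ?_⟩
  obtain ⟨δ, ⟨⟨h1, h2⟩, h3⟩, ha, hB⟩ := hr (j κ) B a
  rw [(j κ).2.2] at h3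
  refine ⟨δ, ⟨h1, ?_⟩, ha, hB⟩
  have h : ∃ κ, (j κ).1 < δ ∧ p δ (j κ) = r₀ := ⟨κ, h2, h3⟩
  simp only [dif_pos h]
  exact j.injective (Subtype.ext (hp δ h.choose_spec.1 h2 (h.choose_spec.2.trans h3.symm)))

end RegOrd

theorem exists_injOn_Iio {Θ R : Type} [LinearOrder Θ] [Nonempty R]
    (h : ∀ y : Θ, Cardinal.mk (Iio y) ≤ Cardinal.mk R) :
    ∃ p : Θ → Θ → R, ∀ y, InjOn (p y) (Iio y) := by
  have : ∀ y : Θ, ∃ q : Θ → R, InjOn q (Iio y) := fun y => by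
    obtain ⟨e⟩ : Nonempty (Iio y ↪ R) := h y
    classical
    refine ⟨fun x => if hx : x < y then e ⟨x, hx⟩ else Classical.arbitrary R, ?_⟩
    intro a ha b hb hab
    simp only [mem_Iio] at ha hb
    simpa [ha, hb, Subtype.ext_iff] using hab
  choose p hp using this
  exact ⟨p, hp⟩

theorem regOrd_toType {c : Cardinal.{0}} (hc : c.IsRegular) : RegOrd c.ord.ToType where
  inf := by simpa using hc.1
  seg a := Cardinal.mk_Iio_lt a (by simp)
  bdd X hX := by
    by_contra! h
    have h1 : Order.cof c.ord.ToType ≤ Cardinal.mk X := Order.cof_le h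
    rw [Ordinal.cof_toType, hc.cof_ord] at h1
    exact absurd h1 (not_le.2 (by simpa using hX))

section Walks

variable {Θ R : Type} [LinearOrder Θ] [LinearOrder R] [WellFoundedLT R]

/-- One step of the walk from `y` towards `x`. -/
def nxt (p : Θ → Θ → R) (x y : Θ) : Θ :=
  open Classical in
  if h : ∃ z, (x ≤ z ∧ z < y) ∧ ∀ w, x ≤ w → w < y → p y z ≤ p y w then h.choose else y

theorem nxt_spec (p : Θ → Θ → R) {x y : Θ} (hxy : x < y) :
    (x ≤ nxt p x y ∧ nxt p x y < y) ∧ ∀ w, x ≤ w → w < y → p y (nxt p x y) ≤ p y w := by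
  have h : ∃ z, (x ≤ z ∧ z < y) ∧ ∀ w, x ≤ w → w < y → p y z ≤ p y w := by
    have hne : (p y '' Ico x y).Nonempty := ⟨_, x, ⟨le_rfl, hxy⟩, rfl⟩
    obtain ⟨z, hz, hz'⟩ := (wellFounded_lt (α := R)).min_mem _ hne
    refine ⟨z, hz, fun w h1 h2 => ?_⟩
    rw [hz']
    exact not_lt.1 ((wellFounded_lt (α := R)).not_lt_min _ (mem_image_of_mem (p y) (show w ∈ Ico x y from ⟨h1, h2⟩)))
  rw [nxt, dif_pos h]
  exact h.choose_spec

theorem nxt_eventually {p : Θ → Θ → R} (hp : ∀ y, InjOn (p y) (Iio y)) (hR : RegOrd R) {δ y : Θ}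
    (hδ : CofGE (Cardinal.mk R) δ) (hy : δ < y) :
    ∃ ν < δ, ∀ x, ν < x → x ≤ δ → nxt p x y = nxt p δ y := by
  obtain ⟨⟨h1, h2⟩, h3⟩ := nxt_spec p hy
  have hX : Cardinal.mk {w | w < δ ∧ p y w < p y (nxt p δ y)} < Cardinal.mk R := by
    refine lt_of_le_of_lt ?_ (hR.seg (p y (nxt p δ y)))
    refine Cardinal.mk_le_of_injective (f := fun w => ⟨p y w.1, w.2.2⟩) fun a b hab => ?_
    exact Subtype.ext (hp y (a.2.1.trans hy) (b.2.1.trans hy) (congrArg Subtype.val hab))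
  obtain ⟨ν, hν, hν'⟩ := hδ _ (fun w hw => hw.1) hX
  refine ⟨ν, hν, fun x hx hxδ => ?_⟩
  obtain ⟨⟨g1, g2⟩, g3⟩ := nxt_spec p (hxδ.trans_lt hy)
  have hle : p y (nxt p x y) ≤ p y (nxt p δ y) := g3 _ (hxδ.trans h1) h2
  refine hp y g2 h2 (le_antisymm hle ?_)
  rcases lt_or_ge (nxt p x y) δ with h | h
  · by_contra hc
    exact absurd (hν' _ ⟨h, not_le.1 hc⟩) (not_le.2 (hx.trans_le g1))
  · exact h3 _ h g2

theorem walk_eventually [WellFoundedLT Θ] {p : Θ → Θ → R} (hp : ∀ y, InjOn (p y) (Iio y))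
    (hR : RegOrd R) {δ : Θ} (hδ : CofGE (Cardinal.mk R) δ) (y : Θ) (hy : δ ≤ y) :
    ∃ N : ℕ, ∃ ν < δ, (nxt p δ)^[N] y = δ ∧
      ∀ x, ν < x → x ≤ δ → ∀ m ≤ N, (nxt p x)^[m] y = (nxt p δ)^[m] y := by
  induction y using WellFoundedLT.induction with
  | ind y ih =>
  rcases hy.eq_or_lt with rfl | hy
  · obtain ⟨ν, hν, -⟩ := hδ ∅ (empty_subset _) (by
      simpa using Cardinal.aleph0_pos.trans_le hR.inf)
    refine ⟨0, ν, hν, rfl, fun x _ _ m hm => ?_⟩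
    obtain rfl : m = 0 := by omega
    rfl
  · obtain ⟨⟨h1, h2⟩, -⟩ := nxt_spec p hy
    obtain ⟨N, ν, hν, hN, hw⟩ := ih _ h2 h1
    obtain ⟨ν', hν', hw'⟩ := nxt_eventually hp hR hδ hy
    refine ⟨N + 1, max ν ν', max_lt hν hν', hN, fun x hx hxδ m hm => ?_⟩
    obtain ⟨hx1, hx2⟩ := max_lt_iff.1 hx
    cases m with
    | zero => rfl
    | succ m =>
      rw [Function.iterate_succ_apply, Function.iterate_succ_apply, hw' x hx2 hxδ,
        hw x hx1 hxδ m (by omega)]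

/-- The point of the walk from `y` to `x` that lies `n` steps after the first visit to a point
with `h`-value at least `j`. -/
def loc {I : Type} [LinearOrder I] (p : Θ → Θ → R) (h : Θ → I) (j : I) (n : ℕ) (x y : Θ) : Θ :=
  (nxt p x)^[sInf {m | j ≤ h ((nxt p x)^[m] y)} + n] y

/-- Walks from `a` to points of `(ν, δ]` pass through `δ`, visiting before that only points with
`h`-value below `j`. -/
def PassThrough {I : Type} [LinearOrder I] (p : Θ → Θ → R) (h : Θ → I) (δ ν : Θ) (j : I)
    (a : Set Θ) : Prop :=
  ∀ y ∈ a, ∃ N : ℕ, ∀ x, ν < x → x ≤ δ →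
    (nxt p x)^[N] y = δ ∧ ∀ m < N, h ((nxt p x)^[m] y) < j

theorem exists_passThrough [WellFoundedLT Θ] {I : Type} [LinearOrder I] (hI : RegOrd I)
    {p : Θ → Θ → R} (hp : ∀ y, InjOn (p y) (Iio y)) (hR : RegOrd R)
    (hIR : Cardinal.mk I ≤ Cardinal.mk R) (h : Θ → I) {δ : Θ} (hδ : CofGE (Cardinal.mk R) δ)
    {a : Set Θ} (ha : Cardinal.mk a < Cardinal.mk I) (haδ : ∀ y ∈ a, δ ≤ y) :
    ∃ ν j, ν < δ ∧ PassThrough p h δ ν j a := by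
  choose N ν hν hN hw using fun y : a => walk_eventually hp hR hδ y.1 (haδ y y.2)
  have hj : ∀ y : a, ∃ j, ∀ m < N y, h ((nxt p δ)^[m] y) < j := fun y => by
    obtain ⟨j, hj⟩ := hI.bddf (K := Fin (N y))
      ((Cardinal.lt_aleph0_of_finite _).trans_le hI.inf) fun m => h ((nxt p δ)^[m] y)
    exact ⟨j, fun m hm => hj ⟨m, hm⟩⟩
  choose j hj using hj
  obtain ⟨j', hj'⟩ := hI.bddf ha j
  obtain ⟨ν', hν', hν''⟩ := hδ (range ν) (by rintro _ ⟨y, rfl⟩; exact hν y)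
    (Cardinal.mk_range_le.trans_lt (ha.trans_le hIR))
  refine ⟨ν', j', hν', fun y hy => ⟨N ⟨y, hy⟩, fun x hx hxδ => ?_⟩⟩
  have hx' := (hν'' _ ⟨⟨y, hy⟩, rfl⟩).trans_lt hx
  refine ⟨(hw ⟨y, hy⟩ x hx' hxδ _ le_rfl).trans (hN _), fun m hm => ?_⟩
  rw [hw ⟨y, hy⟩ x hx' hxδ _ hm.le]
  exact (hj ⟨y, hy⟩ m hm).trans (hj' _)

theorem exists_loc_eq [WellFoundedLT Θ] {I : Type} [LinearOrder I]
    {p : Θ → Θ → R} (hp : ∀ y, InjOn (p y) (Iio y)) (hR : RegOrd R) (h : Θ → I)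
    {ν₁ δ₀ δ₁ : Θ} {j : I} (hδ₀ : CofGE (Cardinal.mk R) δ₀) (h1 : ν₁ < δ₀) (h2 : δ₀ < δ₁)
    (hj : j ≤ h δ₀) :
    ∃ n : ℕ, ∃ ν < δ₀, ∀ a, PassThrough p h δ₁ ν₁ j a → ∀ y ∈ a, ∀ x, ν < x → x ≤ δ₀ →
      loc p h j n x y = δ₀ := by
  obtain ⟨P, ν, hν, hP, hw⟩ := walk_eventually hp hR hδ₀ δ₁ h2.le
  have hne : {m | j ≤ h ((nxt p δ₀)^[m] δ₁)}.Nonempty := ⟨P, by simpa [hP] using hj⟩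
  set m₀ := sInf {m | j ≤ h ((nxt p δ₀)^[m] δ₁)} with hm₀
  have hm₀P : m₀ ≤ P := Nat.sInf_le (by simpa [hP] using hj)
  refine ⟨P - m₀, max ν ν₁, max_lt hν h1, fun a ha y hy x hx hxδ => ?_⟩
  obtain ⟨hx1, hx2⟩ := max_lt_iff.1 hx
  obtain ⟨N, hN⟩ := ha y hy
  obtain ⟨hN1, hN2⟩ := hN x hx2 (hxδ.trans h2.le)
  have hadd : ∀ m ≤ P, (nxt p x)^[m + N] y = (nxt p δ₀)^[m] δ₁ := fun m hm => by
    rw [Function.iterate_add_apply, hN1, hw x hx1 hxδ m hm]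
  have hmin : sInf {m | j ≤ h ((nxt p x)^[m] y)} = m₀ + N := by
    refine le_antisymm (Nat.sInf_le ?_) (le_csInf ⟨m₀ + N, ?_⟩ fun m hm => ?_)
    · rw [mem_ofPred_eq, hadd _ hm₀P]; exact Nat.sInf_mem hne
    · rw [mem_ofPred_eq, hadd _ hm₀P]; exact Nat.sInf_mem hne
    · by_contra! hlt
      rcases lt_or_ge m N with hmN | hmN
      · exact absurd hm (not_le.2 (hN2 m hmN))
      · obtain ⟨k, rfl⟩ := Nat.exists_eq_add_of_le' hmN
        rw [mem_ofPred_eq, hadd k (by omega)] at hm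
        have hle : m₀ ≤ k := Nat.sInf_le hm
        omega
  rw [loc, hmin, show m₀ + N + (P - m₀) = P + N by omega, hadd P le_rfl, hP]

end Walks

/-- On a successor of a regular cardinal `#R`, there are countably many colourings for each `j`
such that every family of few-element sets going off to infinity can be made homogeneous of any
colour against intervals. -/
theorem exists_walk_colouring {Θ R I : Type} [LinearOrder Θ] [WellFoundedLT Θ] [LinearOrder R]
    [WellFoundedLT R] [LinearOrder I] (hΘ : RegOrd Θ) (hR : RegOrd R) (hI : RegOrd I)
    (hRΘ : Cardinal.mk R < Cardinal.mk Θ) (hseg : ∀ y : Θ, Cardinal.mk (Iio y) ≤ Cardinal.mk R)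
    (hIR : Cardinal.mk I ≤ Cardinal.mk R) :
    ∃ col : I → ℕ → Θ → Θ → Θ, ∀ (Λ : Type) [LinearOrder Λ], RegOrd Λ →
      Cardinal.mk Θ < Cardinal.mk Λ → ∀ (G : Set Λ) (A : Λ → Set Θ),
      (∀ γ, Cardinal.mk (A γ) < Cardinal.mk I) →
      (∀ η, Unb {γ ∈ G | ∀ y ∈ A γ, η < y}) → ∀ ε, ∃ j n ν, ∀ s, ∃ G' ⊆ G, Unb G' ∧
        ∀ γ ∈ G', ∀ y ∈ A γ, ∀ x, ν < x → x ≤ s → col j n x y = ε := by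
  have := hΘ.nonempty
  have := hR.nonempty
  have := hI.nonempty
  have hIΘ := hIR.trans_lt hRΘ
  obtain ⟨p, hp⟩ := exists_injOn_Iio hseg
  have hS := hΘ.stat_cofGE hR hRΘ
  have hmul : Cardinal.mk (I × Θ) ≤ Cardinal.mk Θ := by
    rw [Cardinal.mk_prod, Cardinal.lift_id, Cardinal.lift_id]
    exact (mul_le_mul' hIΘ.le le_rfl).trans (Cardinal.mul_eq_self hΘ.inf).le
  obtain ⟨k, hk⟩ := hΘ.stat_split (K := I × Θ) hRΘ hmul p hp hS
  set h : Θ → I := fun δ => (k δ).1 with hh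
  refine ⟨fun j n x y => (k (loc p h j n x y)).2, fun Λ _ hΛ hΘΛ G A hA hG ε => ?_⟩
  have hpass : ∀ δ : Θ, ∃ ν j, CofGE (Cardinal.mk R) δ →
      ν < δ ∧ Unb {γ ∈ G | PassThrough p h δ ν j (A γ)} := fun δ => by
    by_cases hδ : CofGE (Cardinal.mk R) δ
    · have : ∀ γ, ∃ q : Θ × I, (∀ y ∈ A γ, δ < y) → q.1 < δ ∧ PassThrough p h δ q.1 q.2 (A γ) :=
        fun γ => by
        by_cases hγ : ∀ y ∈ A γ, δ < y
        · obtain ⟨ν, j, hν, H⟩ := exists_passThrough hI hp hR hIR h hδ (hA γ)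
            fun y hy => (hγ y hy).le
          exact ⟨⟨ν, j⟩, fun _ => ⟨hν, H⟩⟩
        · exact ⟨Classical.arbitrary _, fun h => absurd h hγ⟩
      choose q hq using this
      obtain ⟨⟨ν, j⟩, hq'⟩ := hΛ.unb_pigeonhole (K := Θ × I) (by
        rw [Cardinal.mk_prod, Cardinal.lift_id, Cardinal.lift_id, mul_comm]
        rw [Cardinal.mk_prod, Cardinal.lift_id, Cardinal.lift_id] at hmul
        exact hmul.trans_lt hΘΛ) (hG δ) q
      obtain ⟨γ₀, ⟨⟨-, h1⟩, h2⟩, -⟩ := hq' (Classical.choice hΛ.nonempty)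
      refine ⟨ν, j, fun _ => ⟨?_, fun b => ?_⟩⟩
      · have := (hq γ₀ h1).1
        rwa [h2] at this
      · obtain ⟨γ, ⟨⟨h0, h1⟩, h2⟩, hb⟩ := hq' b
        have := (hq γ h1).2
        rw [h2] at this
        exact ⟨γ, ⟨h0, this⟩, hb⟩
    · exact ⟨Classical.arbitrary _, Classical.arbitrary _, fun h => absurd h hδ⟩
  choose ν₁ j₁ hν₁ using hpass
  obtain ⟨ν, j, hS1⟩ := hΘ.fodor hIΘ hS ν₁ (fun δ hδ => (hν₁ δ hδ).1) j₁
  have hT : Stat {δ ∈ {δ | CofGE (Cardinal.mk R) δ} | k δ = (j, ε) ∧ ν < δ} := fun B a => by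
    obtain ⟨δ, ⟨h1, h2⟩, h3, h4⟩ := hk (j, ε) B (max a ν)
    obtain ⟨h5, h6⟩ := max_lt_iff.1 h3
    exact ⟨δ, ⟨h1, h2, h6⟩, h5, h4⟩
  have hQ : ∀ δ : Θ, ∃ (n : ℕ) (ν' : Θ), (CofGE (Cardinal.mk R) δ ∧ k δ = (j, ε) ∧ ν < δ) →
      ν' < δ ∧ ∃ G' ⊆ G, Unb G' ∧ ∀ γ ∈ G', ∀ y ∈ A γ, ∀ x, ν' < x → x ≤ δ →
        loc p h j n x y = δ := fun δ => by
    by_cases hδ : CofGE (Cardinal.mk R) δ ∧ k δ = (j, ε) ∧ ν < δ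
    · obtain ⟨δ₁, ⟨hδ₁, e1, e2⟩, hlt⟩ := hS1 δ
      obtain ⟨n, ν', hν', H⟩ := exists_loc_eq hp hR h (j := j) hδ.1 hδ.2.2 hlt
        (by simp [hh, hδ.2.1])
      refine ⟨n, ν', fun _ => ⟨hν', _, ?_, (hν₁ δ₁ hδ₁).2, fun γ hγ => ?_⟩⟩
      · exact fun γ hγ => hγ.1
      · have := hγ.2
        rw [e1, e2] at this
        exact H _ this
    · exact ⟨0, Classical.arbitrary _, fun h => absurd h hδ⟩
  choose n ν' hQ using hQ
  obtain ⟨ν'', n', hT'⟩ := hΘ.fodor (K := ℕ) (by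
    rw [Cardinal.mk_nat]; exact hR.inf.trans_lt hRΘ) hT ν' (fun δ hδ => (hQ δ hδ).1) n
  refine ⟨j, n', ν'', fun s => ?_⟩
  obtain ⟨δ, ⟨hδ, e1, e2⟩, hs⟩ := hT' s
  obtain ⟨-, G', hG', hU, H⟩ := hQ δ hδ
  refine ⟨G', hG', hU, fun γ hγ y hy x hx hxs => ?_⟩
  rw [e1, e2] at H
  simp only [H γ hγ y hy x hx (hxs.trans hs.le), hδ.2.1]

theorem RegOrd.exists_unb_fibres {I K : Type} [LinearOrder I] [Nonempty K] (hI : RegOrd I)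
    (hK : Cardinal.mk K ≤ Cardinal.mk I) : ∃ g : I → K, ∀ κ i, ∃ i', i ≤ i' ∧ g i' = κ := by
  have hmk : Cardinal.mk (I × K) = Cardinal.mk I := by
    rw [Cardinal.mk_prod, Cardinal.lift_id, Cardinal.lift_id]
    exact Cardinal.mul_eq_left hI.inf hK (Cardinal.mk_ne_zero K)
  obtain ⟨e⟩ := Cardinal.eq.1 hmk
  refine ⟨fun i => (e.symm i).2, fun κ i => ?_⟩
  by_contra! h
  have hlt : ∀ x, e (x, κ) < i := fun x => by
    by_contra hc
    exact h _ (not_lt.1 hc) (by simp)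
  refine absurd (hI.seg i) (not_lt.2 ?_)
  refine Cardinal.mk_le_of_injective (f := fun x => ⟨e (x, κ), hlt x⟩) fun x y hxy => ?_
  simpa using e.injective (congrArg Subtype.val hxy)

/-- A sequence of sets of size less than `#I` with `t γ` above `γ`. -/
def Tail (I : Type) {Λ : Type} [LinearOrder Λ] (t : Λ → Set Λ) : Prop :=
  ∀ γ, Cardinal.mk (t γ) < Cardinal.mk I ∧ ∀ ξ ∈ t γ, γ ≤ ξ

section Scale

variable {I Λ : Type} [LinearOrder I] [LinearOrder Λ] {Θ : I → Type} [∀ i, LinearOrder (Θ i)]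

/-- A scale: the functions `f γ` increase modulo bounded sets and are cofinal, and the lengths of
the well-orders involved are as expected. -/
structure AbsScale (f : Λ → ∀ i, Θ i) : Prop where
  regI : RegOrd I
  regΛ : RegOrd Λ
  regΘ : ∀ i, RegOrd (Θ i)
  lt : ∀ i k, i < k → Cardinal.mk (Θ i) < Cardinal.mk (Θ k)
  I_lt : ∀ i, Cardinal.mk I < Cardinal.mk (Θ i)
  lt_Λ : ∀ i, Cardinal.mk (Θ i) < Cardinal.mk Λ
  mono : ∀ γ ξ, γ ≤ ξ → ∃ i₀, ∀ i, i₀ ≤ i → f γ i ≤ f ξ i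
  cof : ∀ g : ∀ i, Θ i, ∃ γ i₀, ∀ i, i₀ ≤ i → g i < f γ i

namespace AbsScale

variable {f : Λ → ∀ i, Θ i}

theorem exists_le_of_small (hf : AbsScale f) {γ : Λ} {a : Set Λ} (ha : Cardinal.mk a < Cardinal.mk I)
    (h : ∀ ξ ∈ a, γ ≤ ξ) : ∃ i₀, ∀ ξ ∈ a, ∀ i, i₀ ≤ i → f γ i ≤ f ξ i := by
  choose i₀ hi₀ using fun ξ : a => hf.mono γ ξ (h ξ ξ.2)
  obtain ⟨b, hb⟩ := hf.regI.bddf ha i₀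
  exact ⟨b, fun ξ hξ i hi => hi₀ ⟨ξ, hξ⟩ i ((hb _).le.trans hi)⟩

theorem unb_above (hf : AbsScale f) {t : Λ → Set Λ} (ht : Tail I t) {G : Set Λ} (hG : Unb G) :
    ∃ i₀, ∀ i, i₀ ≤ i → ∀ η, Unb {γ ∈ G | ∀ ξ ∈ t γ, η < f ξ i} := by
  by_contra! hc
  have hg : ∀ i, ∃ (η : Θ i) (b : Λ), (∃ η, ¬ Unb {γ ∈ G | ∀ ξ ∈ t γ, η < f ξ i}) →
      ∀ γ ∈ G, (∀ ξ ∈ t γ, η < f ξ i) → γ ≤ b := fun i => by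
    by_cases h : ∃ η, ¬ Unb {γ ∈ G | ∀ ξ ∈ t γ, η < f ξ i}
    · obtain ⟨η, hη⟩ := h
      simp only [Unb, not_forall, not_exists, not_and, not_lt] at hη
      obtain ⟨b, hb⟩ := hη
      exact ⟨η, b, fun _ γ h1 h2 => hb γ ⟨h1, h2⟩⟩
    · exact ⟨Classical.choice (hf.regΘ i).nonempty, Classical.choice hf.regΛ.nonempty,
        fun h' => absurd h' h⟩
  choose g b hgb using hg
  obtain ⟨γ₀, i₀, hγ₀⟩ := hf.cof g
  obtain ⟨b', hb'⟩ := hf.regΛ.bddf ((hf.I_lt i₀).trans (hf.lt_Λ i₀)) b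
  obtain ⟨γ, hγ, hγb⟩ := hG (max γ₀ b')
  obtain ⟨h1, h2⟩ := max_lt_iff.1 hγb
  obtain ⟨i₁, hi₁⟩ := hf.exists_le_of_small (ht γ).1 (γ := γ₀)
    fun ξ hξ => h1.le.trans ((ht γ).2 ξ hξ)
  obtain ⟨i, hi, hbad⟩ := hc (max i₀ i₁)
  obtain ⟨hi0, hi1⟩ := max_le_iff.1 hi
  have := hgb i hbad γ hγ fun ξ hξ => (hγ₀ i hi0).trans_le (hi₁ ξ hξ i hi1)
  exact absurd this (not_le.2 ((hb' i).trans h2))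

theorem exists_last_drop (hf : AbsScale f) {t₁ t₂ : Λ → Set Λ} (ht₁ : Tail I t₁) (ht₂ : Tail I t₂)
    {G₁ G₂ : Set Λ} (hG₁ : Unb G₁) (hG₂ : Unb G₂) (B : Λ → Λ) :
    ∃ i₀, ∀ i, i₀ ≤ i → ∃ α ∈ G₁, ∃ β ∈ G₂, B α < β ∧ ∀ ξ ∈ t₁ α, ∀ ζ ∈ t₂ β,
      f ζ i < f ξ i ∧ ∀ k, i < k → f ξ k < f ζ k := by
  obtain ⟨i₀, hi₀⟩ := hf.unb_above ht₁ hG₁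
  obtain ⟨l₀⟩ := hf.regΛ.nonempty
  have hα : ∀ (i : I) (η : Θ i), ∃ α, i₀ ≤ i → α ∈ G₁ ∧ ∀ ξ ∈ t₁ α, η < f ξ i := fun i η => by
    by_cases hi : i₀ ≤ i
    · obtain ⟨α, hα, -⟩ := hi₀ i hi η l₀
      exact ⟨α, fun _ => hα⟩
    · exact ⟨l₀, fun h => absurd h hi⟩
  choose α hα using hα
  have hg : ∀ k, ∃ b : Θ k, ∀ i < k, ∀ η : Θ i, ∀ ξ ∈ t₁ (α i η), f ξ k < b := fun k => by
    choose b1 hb1 using fun (i : I) (η : Θ i) =>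
      (hf.regΘ k).bddf ((ht₁ (α i η)).1.trans (hf.I_lt k)) fun ξ => f ξ k
    choose b2 hb2 using fun (i : Iio k) => (hf.regΘ k).bddf (hf.lt i k i.2) (b1 i)
    obtain ⟨b3, hb3⟩ := (hf.regΘ k).bddf ((hf.regI.seg k).trans (hf.I_lt k)) b2
    exact ⟨b3, fun i hi η ξ hξ =>
      (hb1 i η ⟨ξ, hξ⟩).trans ((hb2 ⟨i, hi⟩ η).trans (hb3 ⟨i, hi⟩))⟩
  choose g hg using hg
  obtain ⟨γ₀, i₁, hγ₀⟩ := hf.cof g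
  choose b1 hb1 using fun i => hf.regΛ.bddf (hf.lt_Λ i) fun η => B (α i η)
  obtain ⟨b2, hb2⟩ := hf.regΛ.bddf ((hf.I_lt i₁).trans (hf.lt_Λ i₁)) b1
  obtain ⟨β, hβ, hβb⟩ := hG₂ (max γ₀ b2)
  obtain ⟨h1, h2⟩ := max_lt_iff.1 hβb
  obtain ⟨i₂, hi₂⟩ := hf.exists_le_of_small (ht₂ β).1 (γ := γ₀)
    fun ξ hξ => h1.le.trans ((ht₂ β).2 ξ hξ)
  refine ⟨max i₀ (max i₁ i₂), fun i hi => ?_⟩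
  obtain ⟨hi0, hi⟩ := max_le_iff.1 hi
  obtain ⟨hi1, hi2⟩ := max_le_iff.1 hi
  obtain ⟨η, hη⟩ := (hf.regΘ i).bddf ((ht₂ β).1.trans (hf.I_lt i)) fun ζ => f ζ i
  obtain ⟨hαG, hαη⟩ := hα i η hi0
  refine ⟨α i η, hαG, β, hβ, (hb1 i η).trans ((hb2 i).trans h2), fun ξ hξ ζ hζ =>
    ⟨(hη ⟨ζ, hζ⟩).trans (hαη ξ hξ), fun k hk => ?_⟩⟩
  exact (hg k i hk η ξ hξ).trans ((hγ₀ k (hi1.trans hk.le)).trans_le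
    (hi₂ ζ hζ k (hi2.trans hk.le)))

theorem exists_colouring (hf : AbsScale f) {M : Type} [Nonempty M] (D : ∀ i, Θ i → M)
    (hD : ∀ k, ∃ i₀, ∀ i, i₀ ≤ i → ∃ e, D i e = k)
    (col : ∀ i, I → ℕ → Θ i → Θ i → Θ i)
    (hcol : ∀ i (G : Set Λ) (A : Λ → Set (Θ i)), (∀ γ, Cardinal.mk (A γ) < Cardinal.mk I) →
      (∀ η, Unb {γ ∈ G | ∀ y ∈ A γ, η < y}) → ∀ ε, ∃ j n ν, ∀ s, ∃ G' ⊆ G, Unb G' ∧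
        ∀ γ ∈ G', ∀ y ∈ A γ, ∀ x, ν < x → x ≤ s → col i j n x y = ε) :
    ∃ c : Λ → Λ → M, ∀ (t₁ t₂ : Λ → Set Λ), Tail I t₁ → Tail I t₂ → ∀ (B : Λ → Λ) k,
      ∃ α β, B α < β ∧ ∀ ξ ∈ t₁ α, ∀ ζ ∈ t₂ β, c ξ ζ = k := by
  have := hf.regI.nonempty
  obtain ⟨g, hg⟩ := hf.regI.exists_unb_fibres (K := I × I × ℕ) (by
    simp only [Cardinal.mk_prod, Cardinal.lift_id, Cardinal.mk_nat]
    rw [Cardinal.mul_aleph0_eq hf.regI.inf, Cardinal.mul_eq_self hf.regI.inf])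
  let drop (ξ ζ : Λ) (i : I) : Prop := f ζ i < f ξ i ∧ ∀ k, i < k → f ξ k < f ζ k
  have huniq : ∀ ξ ζ i k, drop ξ ζ i → drop ξ ζ k → i = k := fun ξ ζ i k hi hk => by
    rcases lt_trichotomy i k with h | h | h
    · exact absurd (hi.2 k h) hk.1.not_gt
    · exact h
    · exact absurd (hk.2 i h) hi.1.not_gt
  have hc : ∀ ξ ζ, ∃ m : M, ∀ i, drop ξ ζ i →
      m = D (g i).1 (col (g i).1 (g i).2.1 (g i).2.2 (f ζ (g i).1) (f ξ (g i).1)) := fun ξ ζ => by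
    by_cases h : ∃ i, drop ξ ζ i
    · obtain ⟨i, hi⟩ := h
      refine ⟨D (g i).1 (col (g i).1 (g i).2.1 (g i).2.2 (f ζ (g i).1) (f ξ (g i).1)),
        fun k hk => ?_⟩
      rw [huniq ξ ζ k i hk hi]
    · exact ⟨Classical.arbitrary M, fun i hi => absurd ⟨i, hi⟩ h⟩
  choose c hc using hc
  refine ⟨c, fun t₁ t₂ ht₁ ht₂ B k => ?_⟩
  have huniv : Unb (univ : Set Λ) := fun a => by simpa using hf.regΛ.exists_gt a
  obtain ⟨i₀, hi₀⟩ := hD k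
  obtain ⟨i₁, hi₁⟩ := hf.unb_above ht₁ huniv
  obtain ⟨i₂, hi₂⟩ := hf.unb_above ht₂ huniv
  obtain ⟨i, hi0, hi1, hi2⟩ : ∃ i, i₀ ≤ i ∧ i₁ ≤ i ∧ i₂ ≤ i :=
    ⟨max i₀ (max i₁ i₂), le_max_left _ _, (le_max_left _ _).trans (le_max_right _ _),
      (le_max_right _ _).trans (le_max_right _ _)⟩
  obtain ⟨e, he⟩ := hi₀ i hi0
  obtain ⟨j, n, ν, H⟩ := hcol i univ (fun γ => (fun ξ => f ξ i) '' t₁ γ)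
    (fun γ => Cardinal.mk_image_le.trans_lt (ht₁ γ).1)
    (fun η => by simpa only [forall_mem_image] using hi₁ i hi1 η) e
  choose s hs using fun β => (hf.regΘ i).bddf ((ht₂ β).1.trans (hf.I_lt i)) fun ζ => f ζ i
  obtain ⟨s₀, hG₂⟩ := hf.regΛ.unb_pigeonhole (hf.lt_Λ i) (hi₂ i hi2 ν) s
  obtain ⟨G₁, -, hG₁, HG₁⟩ := H s₀
  obtain ⟨i₃, hi₃⟩ := hf.exists_last_drop ht₁ ht₂ hG₁ hG₂ B
  obtain ⟨k', hk', hgk⟩ := hg (i, j, n) i₃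
  obtain ⟨α, hα, β, ⟨⟨-, hβ⟩, hβs⟩, hB, hdrop⟩ := hi₃ k' hk'
  refine ⟨α, β, hB, fun ξ hξ ζ hζ => ?_⟩
  rw [hc ξ ζ k' (hdrop ξ hξ ζ hζ), hgk]
  have hle : f ζ i ≤ s₀ := by
    have := hs β ⟨ζ, hζ⟩
    rw [hβs] at this
    exact this.le
  simp only [HG₁ α hα _ (mem_image_of_mem _ hξ) _ (hβ ζ hζ) hle, he]

end AbsScale
end Scale

/-- The points reached from `pr β` by repeatedly moving from `α` to `pr x` with `x ∈ e α`. -/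
def guessStep {Λ : Type} (pr : Λ → Λ) (e : Λ → Set Λ) (β : Λ) : ℕ → Set Λ
  | 0 => {pr β}
  | n + 1 => ⋃ α ∈ guessStep pr e β n, pr '' e α

theorem mk_guessStep_le {Λ : Type} (pr : Λ → Λ) {e : Λ → Set Λ} (β : Λ) {m : Cardinal}
    (hm : Cardinal.aleph0 ≤ m) (he : ∀ α, Cardinal.mk (e α) ≤ m) :
    Cardinal.mk (⋃ n, guessStep pr e β n) ≤ m := by
  have h : ∀ n, Cardinal.mk (guessStep pr e β n) ≤ m := fun n => by
    induction n with
    | zero => simpa [guessStep] using Cardinal.one_lt_aleph0.le.trans hm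
    | succ n ih =>
      refine (Cardinal.mk_biUnion_le _ _).trans ((mul_le_mul' ih (ciSup_le' fun α => ?_)).trans
        (Cardinal.mul_eq_self hm).le)
      exact Cardinal.mk_image_le.trans (he _)
  refine (Cardinal.mk_iUnion_le _).trans ((mul_le_mul' ?_ (ciSup_le' h)).trans
    (Cardinal.mul_eq_self hm).le)
  simpa using hm

theorem Cl_anti {Λ : Type} [LinearOrder Λ] {B B' : Λ → Λ} (h : ∀ x, B x < B' x) : Cl B' ⊆ Cl B :=
  fun _ hδ ν hν => (h ν).trans (hδ ν hν)

theorem exists_projection {Λ : Type} [LinearOrder Λ] [WellFoundedLT Λ] [Nonempty Λ] (B : Λ → Λ) (x : Λ) :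
    ∃ q ≤ x, q ∈ Cl B ∧ ∀ δ ∈ Cl B, δ ≤ x → δ ≤ q := by
  obtain ⟨q, hq⟩ := exists_isLUB_of_wf (X := Cl B ∩ Iic x) ⟨x, fun y hy => hy.2⟩
  refine ⟨q, hq.2 fun y hy => hy.2, fun ν hν => ?_, fun δ h1 h2 => hq.1 ⟨h1, h2⟩⟩
  obtain ⟨δ, hδ, hνδ⟩ := (lt_isLUB_iff hq).1 hν
  exact (hδ.1 ν hνδ).trans_le (hq.1 hδ)

/-- Club guessing. -/
theorem exists_club_guess {Λ I L : Type} [LinearOrder Λ] [WellFoundedLT Λ] [LinearOrder L] [WellFoundedLT L]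
    (hΛ : RegOrd Λ) (hL : RegOrd L) (hIL : Cardinal.mk I < Cardinal.mk L)
    (hLΛ : Cardinal.mk L < Cardinal.mk Λ) (m : I → Cardinal) (hm : ∀ i, Cardinal.aleph0 ≤ m i)
    (hmΛ : ∀ i, Order.succ (m i) < Cardinal.mk Λ) :
    ∃ C : I → Λ → Set Λ, (∀ i δ, Cardinal.mk (C i δ) ≤ m i) ∧ ∀ B : Λ → Λ, ∃ δ₀, ∀ i,
      ∃ δ ∈ C i δ₀, δ ≤ δ₀ ∧ δ ∈ Cl B ∧ CofGE (Order.succ (m i)) δ := by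
  have := hΛ.nonempty
  have hprE := fun B : Λ → Λ => exists_projection B
  choose pr hpr1 hpr2 hpr3 using hprE
  have he : ∀ i (α : Λ), ∃ X ⊆ Iio α, Cardinal.mk X ≤ m i ∧
      (¬ CofGE (Order.succ (m i)) α → ∀ ν < α, ∃ x ∈ X, ν < x) := fun i α => by
    by_cases h : CofGE (Order.succ (m i)) α
    · exact ⟨∅, empty_subset _, by simp, fun h' => absurd h h'⟩
    · have h' := h
      simp only [CofGE, not_forall, not_exists, not_and, not_le] at h'
      obtain ⟨X, hX, hXm, hc⟩ := h'
      exact ⟨X, hX, Order.lt_succ_iff.1 hXm, fun _ ν hν => by simpa using hc ν hν⟩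
  choose e he1 he2 he3 using he
  by_contra! hcon
  choose N hN using fun B => hcon (fun i β => ⋃ n, guessStep (pr B) (e i) β n)
    fun i β => mk_guessStep_le _ _ (hm i) (he2 i)
  obtain ⟨B, hB⟩ := exists_wf_seq (R := L) (Y := Λ → Λ)
    (fun B B' => ∀ x, max (N B x) (B x) < B' x) fun ξ s => by
      choose b hb using fun x => hΛ.bddf ((hL.seg ξ).trans hLΛ) fun η => max (N (s η) x) (s η x)
      exact ⟨b, fun η x => hb x η⟩
  have hanti : ∀ η ξ, η ≤ ξ → Cl (B ξ) ⊆ Cl (B η) := fun η ξ h => by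
    rcases h.eq_or_lt with rfl | h
    · exact subset_rfl
    · exact Cl_anti fun x => (le_max_right _ _).trans_lt (hB _ _ h x)
  choose Binf hBinf using fun x => hΛ.bddf hLΛ fun ξ => B ξ x
  have hstar : ∀ i, ∃ δ, CofGE (Order.succ (m i)) δ ∧ ∀ ξ, δ ∈ Cl (B ξ) := fun i => by
    have hreg : (Order.succ (m i)).IsRegular := Cardinal.isRegular_succ (hm i)
    obtain ⟨δ, hδ, -, hδB⟩ := hΛ.stat_cofGE (regOrd_toType hreg) (by simpa using hmΛ i) Binf
      (Classical.arbitrary Λ)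
    rw [mem_ofPred_eq, Cardinal.mk_ord_toType] at hδ
    exact ⟨δ, hδ, fun ξ => Cl_anti (fun x => hBinf x ξ) hδB⟩
  choose δs hδs hδsB using hstar
  obtain ⟨δ₀, hδ₀⟩ := hΛ.bddf (hIL.trans hLΛ) δs
  have hev : ∀ i x, δs i ≤ x → ∃ q ≤ x, δs i ≤ q ∧ (∀ ξ, q ∈ Cl (B ξ)) ∧
      ∃ ξ₁, ∀ ξ, ξ₁ ≤ ξ → pr (B ξ) x = q := fun i x hx => by
    have hne : (range fun ξ => pr (B ξ) x).Nonempty :=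
      have := hL.nonempty
      range_nonempty _
    obtain ⟨ξ₁, hξ₁⟩ := (wellFounded_lt (α := Λ)).min_mem _ hne
    have hconst : ∀ ξ, ξ₁ ≤ ξ → pr (B ξ) x = pr (B ξ₁) x := fun ξ hξ => by
      refine le_antisymm (hpr3 _ _ _ (hanti _ _ hξ (hpr2 _ _)) (hpr1 _ _)) ?_
      simp only at hξ₁
      rw [hξ₁]
      exact not_lt.1 ((wellFounded_lt (α := Λ)).not_lt_min _
        (mem_range_self (f := fun ξ => pr (B ξ) x) ξ))
    refine ⟨pr (B ξ₁) x, hpr1 _ _, hpr3 _ _ _ (hδsB i ξ₁) hx, fun ξ => ?_, ξ₁, hconst⟩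
    rw [← hconst (max ξ ξ₁) (le_max_right _ _)]
    exact hanti _ _ (le_max_left _ _) (hpr2 _ _)
  have hind : ∀ i α, δs i ≤ α → (∀ ξ, α ∈ Cl (B ξ)) → ∃ ξ₀, ∀ ξ, ξ₀ ≤ ξ → ∀ n β,
      α ∈ guessStep (pr (B ξ)) (e i) β n → ∃ δ ∈ ⋃ n, guessStep (pr (B ξ)) (e i) β n,
        δ ≤ α ∧ (∀ ξ', δ ∈ Cl (B ξ')) ∧ CofGE (Order.succ (m i)) δ := fun i α => by
    induction α using WellFoundedLT.induction with
    | ind α ih =>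
    intro hα hαB
    by_cases hcof : CofGE (Order.succ (m i)) α
    · exact ⟨Classical.choice hL.nonempty, fun ξ _ n β hn =>
        ⟨α, mem_iUnion_of_mem n hn, le_rfl, hαB, hcof⟩⟩
    · have hlt : δs i < α := lt_of_le_of_ne hα fun h => hcof (h ▸ hδs i)
      obtain ⟨x, hx, hxδ⟩ := he3 i α hcof _ hlt
      obtain ⟨q, hqx, hq, hqB, ξ₁, hξ₁⟩ := hev i x hxδ.le
      have hqα : q < α := hqx.trans_lt (he1 i α hx)
      obtain ⟨ξ₀, hξ₀⟩ := ih q hqα hq hqB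
      refine ⟨max ξ₀ ξ₁, fun ξ hξ n β hn => ?_⟩
      obtain ⟨h1, h2⟩ := max_le_iff.1 hξ
      obtain ⟨δ, hδ, hδq, h⟩ := hξ₀ ξ h1 (n + 1) β
        (mem_biUnion hn ⟨x, hx, hξ₁ ξ h2⟩)
      exact ⟨δ, hδ, hδq.trans hqα.le, h⟩
  have hfin : ∀ i, ∃ ξ₀, ∀ ξ, ξ₀ ≤ ξ → ∃ δ ∈ ⋃ n, guessStep (pr (B ξ)) (e i) δ₀ n,
      δ ≤ δ₀ ∧ (∀ ξ', δ ∈ Cl (B ξ')) ∧ CofGE (Order.succ (m i)) δ := fun i => by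
    obtain ⟨q, hqx, hq, hqB, ξ₁, hξ₁⟩ := hev i δ₀ (hδ₀ i).le
    obtain ⟨ξ₀, hξ₀⟩ := hind i q hq hqB
    refine ⟨max ξ₀ ξ₁, fun ξ hξ => ?_⟩
    obtain ⟨h1, h2⟩ := max_le_iff.1 hξ
    obtain ⟨δ, hδ, hδq, h⟩ := hξ₀ ξ h1 0 δ₀ (hξ₁ ξ h2).symm
    exact ⟨δ, hδ, hδq.trans hqx, h⟩
  choose ξ₀ hξ₀ using hfin
  obtain ⟨ξ, hξ⟩ := hL.bddf hIL ξ₀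
  obtain ⟨ξ', hξ'⟩ := hL.exists_gt ξ
  obtain ⟨i, hi⟩ := hN (B ξ) δ₀
  obtain ⟨δ, hδ, hδδ₀, hδB, hδc⟩ := hξ₀ i ξ (hξ i).le
  exact hi δ hδ hδδ₀ (Cl_anti (fun x => (le_max_left _ _).trans_lt (hB _ _ hξ' x)) (hδB ξ')) hδc

theorem CofGE.exists_lt {Λ : Type} [LinearOrder Λ] {ρ : Cardinal} {δ : Λ} (h : CofGE ρ δ)
    (hρ : 0 < ρ) : ∃ ν, ν < δ := by
  obtain ⟨ν, hν, -⟩ := h ∅ (empty_subset _) (by simpa using hρ)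
  exact ⟨ν, hν⟩

theorem AbsScale.exists_strong_colouring {I Λ L M : Type} [LinearOrder I] [LinearOrder Λ]
    [WellFoundedLT Λ] [LinearOrder L] [WellFoundedLT L] {Θ : I → Type} [∀ i, LinearOrder (Θ i)]
    {f : Λ → ∀ i, Θ i} (hf : AbsScale f) (hL : RegOrd L)
    (hIL : Cardinal.mk I < Cardinal.mk L) (hLΛ : Cardinal.mk L < Cardinal.mk Λ)
    (hΘΛ : ∀ i, Order.succ (Cardinal.mk (Θ i)) < Cardinal.mk Λ)
    (hIM : Cardinal.mk I ≤ Cardinal.mk M) (hMΛ : Cardinal.mk M < Cardinal.mk Λ)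
    (hM : ∀ y : Λ, Cardinal.mk (Iio y) ≤ Cardinal.mk M)
    (D : ∀ i, Θ i → M) (hD : ∀ k, ∃ i₀, ∀ i, i₀ ≤ i → ∃ e, D i e = k)
    (col : ∀ i, I → ℕ → Θ i → Θ i → Θ i)
    (hcol : ∀ i (G : Set Λ) (A : Λ → Set (Θ i)), (∀ γ, Cardinal.mk (A γ) < Cardinal.mk I) →
      (∀ η, Unb {γ ∈ G | ∀ y ∈ A γ, η < y}) → ∀ ε, ∃ j n ν, ∀ s, ∃ G' ⊆ G, Unb G' ∧
        ∀ γ ∈ G', ∀ y ∈ A γ, ∀ x, ν < x → x ≤ s → col i j n x y = ε) :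
    ∃ c : Λ → Λ → Λ, ∀ t : Λ → Set Λ, Tail I t → ∀ (B : Λ → Λ) ε,
      ∃ α β, B α < β ∧ ∀ ξ ∈ t α, ∀ ζ ∈ t β, c ξ ζ = ε := by
  have hMinf := hf.regI.inf.trans hIM
  have hM0 : Nonempty M := Cardinal.mk_ne_zero_iff.1 (Cardinal.aleph0_pos.trans_le hMinf).ne'
  obtain ⟨l₀⟩ := hf.regΛ.nonempty
  obtain ⟨i₀⟩ := hf.regI.nonempty
  have m₀ : M := Classical.arbitrary M
  have hprod : Cardinal.mk (I × M) ≤ Cardinal.mk M := by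
    rw [Cardinal.mk_prod, Cardinal.lift_id, Cardinal.lift_id]
    exact (mul_le_mul' hIM le_rfl).trans (Cardinal.mul_eq_self hMinf).le
  obtain ⟨c₁, hc₁⟩ := hf.exists_colouring D hD col hcol
  obtain ⟨C, hCm, hC⟩ := exists_club_guess hf.regΛ hL hIL hLΛ (fun i => Cardinal.mk (Θ i))
    (fun i => (hf.regΘ i).inf) hΘΛ
  obtain ⟨p, hp⟩ := exists_injOn_Iio hM
  obtain ⟨s, hs⟩ : ∃ s : M → I × M, Function.Surjective s := by
    obtain ⟨j⟩ : Nonempty (I × M ↪ M) := hprod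
    have : Nonempty (I × M) := ⟨(i₀, m₀)⟩
    exact ⟨_, Function.invFun_surjective j.injective⟩
  have he : ∀ (δ : Λ) (k : M), ∃ x, ∀ x' < δ, p δ x' = k → x = x' := fun δ k => by
    by_cases h : ∃ x < δ, p δ x = k
    · obtain ⟨x, hx, hxk⟩ := h
      exact ⟨x, fun x' hx' hk => hp δ hx hx' (hxk.trans hk.symm)⟩
    · exact ⟨l₀, fun x hx hk => absurd ⟨x, hx, hk⟩ h⟩
  choose e he using he
  let A (i : I) (ζ : Λ) : Set Λ := ⋃ δ₀ ∈ {δ₀ | δ₀ < ζ ∧ p ζ δ₀ ∈ range (D i)}, C i δ₀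
  have hA : ∀ i ζ, Cardinal.mk (A i ζ) ≤ Cardinal.mk (Θ i) := fun i ζ => by
    refine (Cardinal.mk_biUnion_le _ _).trans ((mul_le_mul' ?_ (ciSup_le' fun α => hCm i _)).trans
      (Cardinal.mul_eq_self (hf.regΘ i).inf).le)
    refine le_trans ?_ (Cardinal.mk_range_le (f := D i))
    refine Cardinal.mk_le_of_injective (f := fun x => ⟨p ζ x.1, x.2.2⟩) fun a b hab => ?_
    exact Subtype.ext (hp ζ a.2.1 b.2.1 (congrArg Subtype.val hab))
  have hc : ∀ ξ ζ, ∃ v, ∀ δ, IsLeast (A (s (c₁ ξ ζ)).1 ζ ∩ Ioi ξ) δ →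
      v = e δ (s (c₁ ξ ζ)).2 := fun ξ ζ => by
    by_cases h : ∃ δ, IsLeast (A (s (c₁ ξ ζ)).1 ζ ∩ Ioi ξ) δ
    · obtain ⟨δ, hδ⟩ := h
      exact ⟨e δ (s (c₁ ξ ζ)).2, fun δ' hδ' => by rw [hδ.unique hδ']⟩
    · exact ⟨l₀, fun δ hδ => absurd ⟨δ, hδ⟩ h⟩
  choose c hc using hc
  refine ⟨c, fun t ht B ε => ?_⟩
  have hT : Stat {δ | ε < δ ∧ ∃ i β, δ ≤ β ∧ (∀ ζ ∈ t β, δ ∈ A i ζ) ∧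
      CofGE (Order.succ (Cardinal.mk (Θ i))) δ} := fun B' a => by
    obtain ⟨δ₀, hδ₀⟩ := hC fun ν => max (B' ν) (max a ε)
    obtain ⟨β, hβ⟩ := hf.regΛ.exists_gt δ₀
    choose iz hiz using fun ζ : t β => hD (p ζ δ₀)
    obtain ⟨i, hi⟩ := hf.regI.bddf (ht β).1 iz
    obtain ⟨δ, hδ, hδδ₀, hδB, hδc⟩ := hδ₀ i
    obtain ⟨ν, hν⟩ := hδc.exists_lt ((zero_le).trans_lt (Order.lt_succ _))
    obtain ⟨-, h2⟩ := max_lt_iff.1 (hδB ν hν)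
    obtain ⟨h2, h3⟩ := max_lt_iff.1 h2
    refine ⟨δ, ⟨h3, i, β, hδδ₀.trans hβ.le, fun ζ hζ => ?_, hδc⟩, h2,
      fun ν hν => (le_max_left _ _).trans_lt (hδB ν hν)⟩
    exact mem_biUnion ⟨hβ.trans_le ((ht β).2 ζ hζ), hiz ⟨ζ, hζ⟩ i (hi _).le⟩ hδ
  have hsel : ∀ δ, ∃ (ν : Λ) (i : I) (k : M) (β : Λ),
      (ε < δ ∧ ∃ i β, δ ≤ β ∧ (∀ ζ ∈ t β, δ ∈ A i ζ) ∧
        CofGE (Order.succ (Cardinal.mk (Θ i))) δ) →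
      ν < δ ∧ δ ≤ β ∧ e δ k = ε ∧ ∀ ζ ∈ t β, δ ∈ A i ζ ∧ ∀ z ∈ A i ζ, z < δ → z ≤ ν := fun δ => by
    by_cases h : ε < δ ∧ ∃ i β, δ ≤ β ∧ (∀ ζ ∈ t β, δ ∈ A i ζ) ∧
        CofGE (Order.succ (Cardinal.mk (Θ i))) δ
    · obtain ⟨hε, i, β, hβ, hA', hδ⟩ := h
      obtain ⟨ν, hν, hν'⟩ := hδ ((⋃ ζ ∈ t β, A i ζ) ∩ Iio δ) inter_subset_right (by
        refine Order.lt_succ_iff.2 ((Cardinal.mk_le_mk_of_subset inter_subset_left).trans ?_)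
        refine (Cardinal.mk_biUnion_le _ _).trans ((mul_le_mul' ((ht β).1.trans (hf.I_lt i)).le
          (ciSup_le' fun α => hA i _)).trans (Cardinal.mul_eq_self (hf.regΘ i).inf).le))
      exact ⟨ν, i, p δ ε, β, fun _ => ⟨hν, hβ, he _ _ _ hε rfl, fun ζ hζ =>
        ⟨hA' ζ hζ, fun z hz hzδ => hν' z ⟨mem_biUnion hζ hz, hzδ⟩⟩⟩⟩
    · exact ⟨l₀, i₀, m₀, l₀, fun h' => absurd h' h⟩
  choose ν i k β hsel using hsel
  obtain ⟨ν₀, ⟨i₁, k₁⟩, hT'⟩ := hf.regΛ.fodor (hprod.trans_lt hMΛ) hT ν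
    (fun δ hδ => (hsel δ hδ).1) fun δ => (i δ, k δ)
  choose δ hδ hγδ using hT'
  obtain ⟨ν₁, hν₁⟩ := hf.regΛ.exists_gt ν₀
  obtain ⟨k', hk'⟩ := hs (i₁, k₁)
  have hB₁ : ∀ γ, ∃ b, B (max γ ν₁) < b ∧ ∀ ξ ∈ t (max γ ν₁), ξ < b := fun γ => by
    obtain ⟨b, hb⟩ := hf.regΛ.bdd (t (max γ ν₁))
      ((ht _).1.trans ((hf.I_lt i₀).trans (hf.lt_Λ i₀)))
    obtain ⟨b', h1, h2⟩ := hf.regΛ.exists_gt₂ (B (max γ ν₁)) b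
    exact ⟨b', h1, fun ξ hξ => (hb ξ hξ).trans h2⟩
  choose B₁ hB₁ hB₁' using hB₁
  have ht₂ : ∀ γ, γ ≤ β (δ γ) := fun γ => (hγδ γ).le.trans (hsel _ (hδ γ).1).2.1
  obtain ⟨γ, γ', hγγ', H⟩ := hc₁ (fun γ => t (max γ ν₁)) (fun γ => t (β (δ γ)))
    (fun γ => ⟨(ht _).1, fun ξ hξ => (le_max_left _ _).trans ((ht _).2 ξ hξ)⟩)
    (fun γ => ⟨(ht _).1, fun ξ hξ => (ht₂ γ).trans ((ht _).2 ξ hξ)⟩) B₁ k'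
  refine ⟨max γ ν₁, β (δ γ'), (hB₁ γ).trans (hγγ'.trans_le (ht₂ γ')), fun ξ hξ ζ hζ => ?_⟩
  obtain ⟨hT', hν, hik⟩ := hδ γ'
  obtain ⟨-, -, heε, hz⟩ := hsel _ hT'
  obtain ⟨h1, h2⟩ := hz ζ hζ
  simp only [Prod.mk.injEq] at hik
  rw [hν, hik.1] at h2
  rw [hik.1] at h1
  rw [hik.2] at heε
  have hc1 := H ξ hξ ζ hζ
  have hleast : IsLeast (A (s (c₁ ξ ζ)).1 ζ ∩ Ioi ξ) (δ γ') := by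
    rw [hc1, hk']
    refine ⟨⟨h1, (hB₁' γ ξ hξ).trans (hγγ'.trans (hγδ γ'))⟩, fun z hzA => not_lt.1 fun hlt => ?_⟩
    exact absurd ((hν₁.trans_le ((le_max_right _ _).trans ((ht _).2 ξ hξ))).trans hzA.2)
      (not_lt.2 (h2 z hzA.1 hlt))
  rw [hc ξ ζ _ hleast, hc1, hk', heε]

/-- The ordinal represented by an element of a canonical well-order. -/
def ordVal {o : Ordinal} (x : o.ToType) : Ordinal := (Ordinal.ToType.mk.symm x).1

theorem ordVal_lt {o : Ordinal} (x : o.ToType) : ordVal x < o := (Ordinal.ToType.mk.symm x).2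

theorem ordVal_lt_ordVal {o : Ordinal} {x y : o.ToType} : ordVal x < ordVal y ↔ x < y :=
  Ordinal.ToType.mk.symm.lt_iff_lt

theorem ordVal_le_ordVal {o : Ordinal} {x y : o.ToType} : ordVal x ≤ ordVal y ↔ x ≤ y :=
  Ordinal.ToType.mk.symm.le_iff_le

theorem ordVal_injective {o : Ordinal} : Function.Injective (ordVal (o := o)) :=
  Subtype.val_injective.comp Ordinal.ToType.mk.symm.injective

theorem exists_ordVal_eq {o a : Ordinal} (h : a < o) : ∃ x : o.ToType, ordVal x = a :=
  ⟨Ordinal.ToType.mk ⟨a, h⟩, by simp [ordVal]⟩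

theorem pr1_of_colouring {mu : Cardinal} (hmu : Cardinal.aleph0 ≤ mu)
    (hχ : Ordinal.cof mu.ord < mu)
    (h : ∃ c : (sucOrd mu).ToType → (sucOrd mu).ToType → (sucOrd mu).ToType,
      ∀ t : (sucOrd mu).ToType → Set (sucOrd mu).ToType, Tail (cofOrd mu).ToType t →
        ∀ (B : (sucOrd mu).ToType → (sucOrd mu).ToType) ε,
          ∃ α β, B α < β ∧ ∀ ξ ∈ t α, ∀ ζ ∈ t β, c ξ ζ = ε) :
    Pr1 mu (Order.succ mu) := by
  have hΛ : RegOrd (sucOrd mu).ToType := regOrd_toType (Cardinal.isRegular_succ hmu)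
  have hIc : Cardinal.mk (cofOrd mu).ToType = Ordinal.cof mu.ord := Cardinal.mk_ord_toType _
  have hΛc : Cardinal.mk (sucOrd mu).ToType = Order.succ mu := Cardinal.mk_ord_toType _
  obtain ⟨l₀⟩ := hΛ.nonempty
  obtain ⟨c, hc⟩ := h
  have hw : ∀ a, ∃ x : (sucOrd mu).ToType, a < sucOrd mu → ordVal x = a := fun a => by
    by_cases h : a < sucOrd mu
    · exact (exists_ordVal_eq h).imp fun x hx _ => hx
    · exact ⟨l₀, fun h' => absurd h' h⟩
  choose w hw using hw
  refine ⟨fun a b => ordVal (c (w a) (w b)), fun a b _ _ => ordVal_lt _,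
    fun t ht hdisj hcard ε hε => ?_⟩
  let tt : (sucOrd mu).ToType → Set (sucOrd mu).ToType := fun γ => ordVal ⁻¹' t (ordVal γ)
  have htt : ∀ γ, Cardinal.mk (tt γ) < Cardinal.mk (cofOrd mu).ToType := fun γ => by
    have h1 := Cardinal.mk_preimage_of_injective_lift ordVal (t (ordVal γ)) ordVal_injective
      (α := (sucOrd mu).ToType)
    have h2 := hcard _ (ordVal_lt γ)
    rw [CardLT] at h2
    rw [hIc, ← Cardinal.lift_lt.{0, 1}]
    refine lt_of_le_of_lt ?_ h2
    simpa using h1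
  have hα : ∀ γ, ∃ α, γ ≤ α ∧ ∀ ξ ∈ tt α, γ ≤ ξ := fun γ => by
    have hX : Cardinal.mk {a | ∃ ξ ∈ tt a, ξ < γ} < Cardinal.mk (sucOrd mu).ToType := by
      refine lt_of_le_of_lt ?_ (hΛ.seg γ)
      choose g hg hgγ using fun a : {a | ∃ ξ ∈ tt a, ξ < γ} => a.2
      refine Cardinal.mk_le_of_injective (f := fun a => ⟨g a, hgγ a⟩) fun a b hab => ?_
      by_contra hne
      have hd := hdisj (ordVal a.1) (ordVal b.1) (ordVal_lt _) (ordVal_lt _)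
        fun h => hne (Subtype.ext (ordVal_injective h))
      have hab' : g a = g b := congrArg Subtype.val hab
      have hb := hg b
      rw [← hab'] at hb
      exact disjoint_left.1 hd (hg a) hb
    obtain ⟨b, hb⟩ := hΛ.bdd _ hX
    refine ⟨max γ b, le_max_left _ _, fun ξ hξ => not_lt.1 fun hlt => ?_⟩
    exact absurd (hb (max γ b) ⟨ξ, hξ, hlt⟩) (not_lt.2 (le_max_right _ _))
  choose α hγα hα using hα
  have hB : ∀ γ, ∃ b, α γ < b ∧ ∀ ξ ∈ tt (α γ), ξ < b := fun γ => by
    obtain ⟨b, hb⟩ := hΛ.bdd (tt (α γ)) ((htt _).trans (by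
      rw [hIc, hΛc]; exact hχ.trans (Order.lt_succ _)))
    obtain ⟨b', h1, h2⟩ := hΛ.exists_gt₂ (α γ) b
    exact ⟨b', h1, fun ξ hξ => (hb ξ hξ).trans h2⟩
  choose B hB hB' using hB
  obtain ⟨ε', rfl⟩ := exists_ordVal_eq (show ε < sucOrd mu from hε)
  obtain ⟨γ, γ', hγ, H⟩ := hc (fun γ => tt (α γ)) (fun γ => ⟨htt _, hα γ⟩) B ε'
  refine ⟨ordVal (α γ), ordVal (α γ'), ordVal_lt_ordVal.2 ((hB γ).trans (hγ.trans_le (hγα γ'))),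
    ordVal_lt _, fun ξ hξ ζ hζ => ?_⟩
  obtain ⟨ξ, rfl⟩ := exists_ordVal_eq (ht _ (ordVal_lt _) hξ)
  obtain ⟨ζ, rfl⟩ := exists_ordVal_eq (ht _ (ordVal_lt _) hζ)
  have hlt : ordVal ξ < ordVal ζ :=
    ordVal_lt_ordVal.2 ((hB' γ ξ hξ).trans (hγ.trans_le (hα γ' ζ hζ)))
  have hwv : ∀ x : (sucOrd mu).ToType, w (ordVal x) = x := fun x =>
    ordVal_injective (hw _ (ordVal_lt x))
  rw [min_eq_left hlt.le, max_eq_right hlt.le]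
  simp only [hwv, H ξ hξ ζ hζ]

namespace IsScale

variable {mu : Cardinal} {mus : Ordinal → Cardinal} {f : Ordinal → Ordinal → Ordinal}

theorem isRegular_cof (hmu : Cardinal.aleph0 ≤ mu) : (Ordinal.cof mu.ord).IsRegular :=
  Cardinal.isRegular_cof (Cardinal.isSuccLimit_ord hmu)

theorem mus_mono (hs : IsScale mu mus f) {i j : Ordinal} (hij : i ≤ j) (hj : j < cofOrd mu) :
    mus i ≤ mus j := by
  rcases hij.eq_or_lt with rfl | h
  · exact le_rfl
  · exact (hs.strictMono _ _ h hj).le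

theorem mus_lt (hmu : Cardinal.aleph0 ≤ mu) (hs : IsScale mu mus f) {i : Ordinal}
    (hi : i < cofOrd mu) : mus i < mu := by
  have hlim : Order.IsSuccLimit (cofOrd mu) := Cardinal.isSuccLimit_ord (isRegular_cof hmu).1
  have hi' := hlim.succ_lt hi
  exact (hs.strictMono _ _ (Order.lt_succ i) hi').trans_le (hs.le_mu _ hi')

theorem cof_lt_mus (hs : IsScale mu mus f) {i : Ordinal} (hi : i < cofOrd mu) :
    Ordinal.cof mu.ord < mus i :=
  hs.cof_lt.trans_le (hs.mus_mono (zero_le) hi)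

/-- The functions of a scale, on canonical well-orders. -/
def toFun (hs : IsScale mu mus f) (γ : (sucOrd mu).ToType) (i : (cofOrd mu).ToType) :
    (mus (ordVal i)).ord.ToType :=
  (exists_ordVal_eq (hs.f_lt _ (ordVal_lt γ) _ (ordVal_lt i))).choose

theorem ordVal_toFun (hs : IsScale mu mus f) (γ : (sucOrd mu).ToType)
    (i : (cofOrd mu).ToType) : ordVal (hs.toFun γ i) = f (ordVal γ) (ordVal i) :=
  (exists_ordVal_eq (hs.f_lt _ (ordVal_lt γ) _ (ordVal_lt i))).choose_spec

theorem absScale (hmu : Cardinal.aleph0 ≤ mu) (hs : IsScale mu mus f) : AbsScale hs.toFun where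
  regI := regOrd_toType (isRegular_cof hmu)
  regΛ := regOrd_toType (Cardinal.isRegular_succ hmu)
  regΘ i := regOrd_toType (hs.regular _ (ordVal_lt i))
  lt i k hik := by
    simpa using hs.strictMono _ _ (ordVal_lt_ordVal.2 hik) (ordVal_lt k)
  I_lt i := by
    simpa [cofOrd] using hs.cof_lt_mus (ordVal_lt i)
  lt_Λ i := by
    simpa [sucOrd] using hs.le_mu _ (ordVal_lt i)
  mono γ ξ h := by
    obtain ⟨i₀⟩ := (regOrd_toType (isRegular_cof hmu)).nonempty
    rcases h.eq_or_lt with rfl | h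
    · exact ⟨i₀, fun i _ => le_rfl⟩
    · obtain ⟨i₀, hi₀, H⟩ := hs.f_mono _ _ (ordVal_lt_ordVal.2 h) (ordVal_lt ξ)
      obtain ⟨i₀, rfl⟩ := exists_ordVal_eq hi₀
      refine ⟨i₀, fun i hi => ordVal_le_ordVal.1 ?_⟩
      rw [hs.ordVal_toFun, hs.ordVal_toFun]
      exact (H _ (ordVal_le_ordVal.2 hi) (ordVal_lt i)).le
  cof g := by
    have hg := (ordVal_injective (o := cofOrd mu)).extend_apply (fun i => ordVal (g i)) 0
    obtain ⟨γ, hγ, i₀, hi₀, H⟩ := hs.f_cofinal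
      (Function.extend ordVal (fun i : (cofOrd mu).ToType => ordVal (g i)) 0) fun i hi => by
        obtain ⟨i, rfl⟩ := exists_ordVal_eq hi
        rw [hg]
        exact ordVal_lt _
    obtain ⟨γ, rfl⟩ := exists_ordVal_eq hγ
    obtain ⟨i₀, rfl⟩ := exists_ordVal_eq hi₀
    refine ⟨γ, i₀, fun i hi => ordVal_lt_ordVal.1 ?_⟩
    have := H _ (ordVal_le_ordVal.2 hi) (ordVal_lt i)
    rwa [hg, ← hs.ordVal_toFun] at this

end IsScale

/-- If some scale `(mus, f)` for the singular cardinal `μ` has each `μ_i` the double successor of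
an uncountable regular cardinal, then `pr₁(μ⁺,μ⁺,μ⁺,cf μ)` holds. -/
theorem stmt7 (mu : Cardinal) (hsing : IsSingular mu)
    (h : ∃ mus f, IsScale mu mus f ∧ ∀ i, i < cofOrd mu →
      ∃ κ : Cardinal, κ.IsRegular ∧ Cardinal.aleph0 < κ ∧
        mus i = Order.succ (Order.succ κ)) :
    Pr1 mu (Order.succ mu) := by
  obtain ⟨hmu, hcof⟩ := hsing
  obtain ⟨mus, f, hs, hκ⟩ := h
  have hχ := IsScale.isRegular_cof hmu
  have hf := hs.absScale hmu
  choose κ hκr _ hmus using fun i : (cofOrd mu).ToType => hκ _ (ordVal_lt i)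
  have hle : ∀ i, Ordinal.cof mu.ord ≤ Order.succ (κ i) := fun i => by
    have hlt := hs.cof_lt_mus (ordVal_lt i)
    rwa [hmus, Order.lt_succ_iff] at hlt
  have hcol := fun i => exists_walk_colouring (hf.regΘ i)
    (regOrd_toType (Cardinal.isRegular_succ (hκr i).1)) hf.regI (by simp [hmus])
    (fun y => by
      rw [Cardinal.mk_ord_toType]
      refine Order.lt_succ_iff.1 (((hf.regΘ i).seg y).trans_eq ?_)
      rw [Cardinal.mk_ord_toType, hmus])
    (by simpa [cofOrd] using hle i)
  choose col hcol using hcol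
  have hD : ∀ (i : (cofOrd mu).ToType) (x : (mus (ordVal i)).ord.ToType),
      ∃ m : mu.ord.ToType, ordVal m = ordVal x := fun i x =>
    exists_ordVal_eq ((ordVal_lt x).trans_le (Cardinal.ord_le_ord.2 (hs.le_mu _ (ordVal_lt i))))
  choose D hD using hD
  refine pr1_of_colouring hmu hcof (hf.exists_strong_colouring (M := mu.ord.ToType)
    (regOrd_toType (Cardinal.isRegular_succ hχ.1)) ?_ ?_ (fun i => ?_) ?_ ?_ (fun y => ?_) D
    (fun k => ?_) col fun i => hcol i _ hf.regΛ (hf.lt_Λ i))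
  · simp [cofOrd]
  · simpa [sucOrd] using hcof
  · simpa [sucOrd] using IsScale.mus_lt hmu hs (ordVal_lt i)
  · simpa [cofOrd] using hcof.le
  · simp [sucOrd]
  · simpa [sucOrd] using hf.regΛ.seg y
  · obtain ⟨i₀, hi₀, h⟩ := hs.unbdd _ (Cardinal.lt_ord.1 (ordVal_lt k))
    obtain ⟨i₀, rfl⟩ := exists_ordVal_eq hi₀
    refine ⟨i₀, fun i hi => ?_⟩
    obtain ⟨e, he⟩ := exists_ordVal_eq (Cardinal.lt_ord.2
      (h.trans_le (hs.mus_mono (ordVal_le_ordVal.2 hi) (ordVal_lt i))))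
    exact ⟨e, ordVal_injective ((hD i e).trans he)⟩

end
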